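/- arXiv:2412.14744 — 2 statements merged into one kernel-verified Lean document; each statement's English description precedes it below -/
import Mathlib

section
/- Let N be a positive integer and ε > 0 with 4πεN < 1, and let C_ε be a finite subset of [-1,1] that is an ε-cover of [-1,1] (for every x ∈ [-1,1] there exists x' ∈ C_ε with |x − x'| ≤ ε). Then for every trigonometric polynomial T ∈ 𝕋_N: sup_{x ∈ [-1,1]} |T(x)| ≤ (1 − 4πεN)^{-1} · max_{x ∈ C_ε} |T(x)|. -/
open Real MeasureTheory Set

noncomputable section

/-- A trigonometric polynomial of degree at most `N` on `[-1,1]`: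
`T x = θ₀ + ∑_{t=1}^N (a t * cos (tπx) + b t * sin (tπx))`. -/
def IsTrigPoly (N : ℕ) (T : ℝ → ℝ) : Prop :=
  ∃ θ₀ : ℝ, ∃ a b : ℕ → ℝ, ∀ x : ℝ,
    T x = θ₀ + ∑ t ∈ Finset.Icc 1 N,
      (a t * Real.cos (t * π * x) + b t * Real.sin (t * π * x))

/-- The exponential `x ↦ exp (i m π x)`. -/
def expMode (m : ℤ) (x : ℝ) : ℂ := Complex.exp (m * π * x * Complex.I)

lemma expMode_mul (m n : ℤ) (x : ℝ) : expMode m x * expMode n x = expMode (m + n) x := by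
  simp only [expMode, ← Complex.exp_add]
  push_cast
  ring_nf

lemma expMode_add (m : ℤ) (x y : ℝ) : expMode m (x + y) = expMode m x * expMode m y := by
  simp only [expMode, ← Complex.exp_add]
  push_cast
  ring_nf

lemma norm_expMode (m : ℤ) (x : ℝ) : ‖expMode m x‖ = 1 := by
  have := Complex.norm_exp_ofReal_mul_I (m * π * x)
  push_cast at this
  exact this

lemma conj_expMode (m : ℤ) (x : ℝ) : (starRingEnd ℂ) (expMode m x) = expMode (-m) x := by
  simp [expMode, ← Complex.exp_conj]

lemma hasDerivAt_expMode (m : ℤ) (x : ℝ) :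
    HasDerivAt (expMode m) (m * π * Complex.I * expMode m x) x := by
  have h1 : HasDerivAt (fun x : ℝ => (m * π * x * Complex.I : ℂ)) (m * π * Complex.I) x := by
    have h2 := ((hasDerivAt_id x).ofReal_comp.const_mul (m * π : ℂ)).mul_const Complex.I
    simpa using h2
  rw [mul_comm]
  exact h1.cexp

lemma expMode_zero (x : ℝ) : expMode 0 x = 1 := by simp [expMode]

lemma ofReal_cos_eq_expMode (t : ℕ) (x : ℝ) :
    ((Real.cos (t * π * x) : ℝ) : ℂ) = 1 / 2 * expMode t x + 1 / 2 * expMode (-t) x := by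
  rw [Complex.ofReal_cos, Complex.cos, expMode, expMode]
  push_cast
  ring_nf

lemma ofReal_sin_eq_expMode (t : ℕ) (x : ℝ) :
    ((Real.sin (t * π * x) : ℝ) : ℂ) =
      -Complex.I / 2 * expMode t x + Complex.I / 2 * expMode (-t) x := by
  rw [Complex.ofReal_sin, Complex.sin, expMode, expMode]
  push_cast
  ring_nf

/-- Orthogonality of the exponentials on the grid of `4 * N` equally spaced points of a period. -/
lemma sum_expMode_grid {N : ℕ} (hN : 0 < N) {m : ℤ} (hm : |m| < 4 * N) :
    ∑ j ∈ Finset.range (4 * N), expMode m (j / (2 * N)) = if m = 0 then (4 * N : ℂ) else 0 := by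
  have hN' : (N : ℂ) ≠ 0 := by exact_mod_cast hN.ne'
  split_ifs with h
  · subst h
    simp [expMode_zero]
  · have hpow (j : ℕ) : expMode m (j / (2 * N)) = expMode m (1 / (2 * N)) ^ j := by
      rw [expMode, expMode, ← Complex.exp_nat_mul]
      push_cast
      ring_nf
    simp_rw [hpow]
    have hone : expMode m (1 / (2 * N)) ^ (4 * N) = 1 := by
      rw [expMode, ← Complex.exp_nat_mul, Complex.exp_eq_one_iff]
      refine ⟨m, ?_⟩
      push_cast
      field_simp
      ring
    have hne : expMode m (1 / (2 * N)) ≠ 1 := by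
      rw [expMode, Ne, Complex.exp_eq_one_iff]
      rintro ⟨k, hk⟩
      have hmk : (m : ℂ) = k * (4 * N) := by
        have hpi : (π : ℂ) ≠ 0 := by exact_mod_cast Real.pi_ne_zero
        have hI := Complex.I_ne_zero
        push_cast at hk
        field_simp at hk
        linear_combination hk
      have hmk' : m = k * (4 * N) := by exact_mod_cast hmk
      apply h
      exact Int.eq_zero_of_abs_lt_dvd (m := 4 * N) ⟨k, by rw [hmk']; ring⟩ hm
    have hgeom := geom_sum_mul (expMode m (1 / (2 * N))) (4 * N)
    rw [hone, sub_self] at hgeom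
    exact (mul_eq_zero.mp hgeom).resolve_right (sub_ne_zero.mpr hne)

/-- The Dirichlet-type sum `∑_{a < 2N} exp (i a π x)`. -/
def dirichletSum (N : ℕ) (x : ℝ) : ℂ := ∑ a ∈ Finset.range (2 * N), expMode a x

lemma sum_dirichletSum_sq_mul_expMode {N : ℕ} (hN : 0 < N) {d : ℕ} (hd : d ≤ 2 * N) :
    ∑ j ∈ Finset.range (4 * N), dirichletSum N (j / (2 * N)) *
        (starRingEnd ℂ) (dirichletSum N (j / (2 * N))) * expMode (-d) (j / (2 * N)) =
      4 * N * (2 * N - d) := by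
  have hexpand (x : ℝ) : dirichletSum N x * (starRingEnd ℂ) (dirichletSum N x) * expMode (-d) x =
      ∑ b ∈ Finset.range (2 * N), ∑ a ∈ Finset.range (2 * N),
        expMode ((a : ℤ) - b - d) x := by
    rw [dirichletSum, map_sum, Finset.sum_mul_sum, Finset.sum_comm, Finset.sum_mul]
    refine Finset.sum_congr rfl fun b _ => ?_
    rw [Finset.sum_mul]
    refine Finset.sum_congr rfl fun a _ => ?_
    rw [conj_expMode, expMode_mul, expMode_mul]
    ring_nf
  simp_rw [hexpand]
  rw [Finset.sum_comm]
  have hinner : ∀ b ∈ Finset.range (2 * N),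
      ∑ j ∈ Finset.range (4 * N), ∑ a ∈ Finset.range (2 * N),
        expMode ((a : ℤ) - b - d) (j / (2 * N)) =
      if b ∈ Finset.range (2 * N - d) then (4 * N : ℂ) else 0 := by
    intro b hb
    rw [Finset.sum_comm]
    have hb' := Finset.mem_range.mp hb
    have hmode : ∀ a ∈ Finset.range (2 * N),
        ∑ j ∈ Finset.range (4 * N), expMode ((a : ℤ) - b - d) (j / (2 * N)) =
          if a = b + d then (4 * N : ℂ) else 0 := by
      intro a ha
      have ha' := Finset.mem_range.mp ha
      rw [sum_expMode_grid hN (by rw [abs_lt]; omega)]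
      exact if_congr (by omega) rfl rfl
    rw [Finset.sum_congr rfl hmode, Finset.sum_ite_eq']
    exact if_congr (by simp only [Finset.mem_range]; omega) rfl rfl
  rw [Finset.sum_congr rfl hinner, Finset.sum_ite_mem,
    Finset.inter_eq_right.mpr (Finset.range_mono (Nat.sub_le _ _)), Finset.sum_const,
    Finset.card_range, nsmul_eq_mul, Nat.cast_sub hd]
  push_cast
  ring

/-- Weights of a quadrature formula which multiplies the `t`-th exponential by `t + N`. -/
def fejerWeight (N j : ℕ) : ℂ :=
  (4 * N : ℂ)⁻¹ * (dirichletSum N (j / (2 * N)) *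
    (starRingEnd ℂ) (dirichletSum N (j / (2 * N))) * expMode (-N) (j / (2 * N)))

lemma sum_norm_fejerWeight {N : ℕ} (hN : 0 < N) :
    ∑ j ∈ Finset.range (4 * N), ‖fejerWeight N j‖ = 2 * N := by
  have hN' : (N : ℂ) ≠ 0 := by exact_mod_cast hN.ne'
  have hsum := sum_dirichletSum_sq_mul_expMode hN (Nat.zero_le (2 * N))
  have hnorm (j : ℕ) : ((‖fejerWeight N j‖ : ℝ) : ℂ) = (4 * N : ℂ)⁻¹ *
      (dirichletSum N (j / (2 * N)) * (starRingEnd ℂ) (dirichletSum N (j / (2 * N))) *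
        expMode (-(0 : ℕ)) (j / (2 * N))) := by
    rw [fejerWeight, norm_mul, norm_mul, norm_mul, norm_expMode, RCLike.norm_conj,
      Nat.cast_zero, neg_zero, expMode_zero, Complex.mul_conj, Complex.normSq_eq_norm_sq]
    simp only [norm_inv, norm_mul, Complex.norm_natCast, Complex.norm_ofNat]
    push_cast
    ring
  apply Complex.ofReal_injective
  rw [Complex.ofReal_sum]
  simp_rw [hnorm]
  rw [← Finset.mul_sum, hsum]
  push_cast
  field_simp
  ring

lemma sum_fejerWeight_mul_expMode {N : ℕ} (hN : 0 < N) {t : ℤ} (ht : |t| ≤ N) :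
    ∑ j ∈ Finset.range (4 * N), fejerWeight N j * expMode t (j / (2 * N)) = t + N := by
  have hN' : (N : ℂ) ≠ 0 := by exact_mod_cast hN.ne'
  rw [abs_le] at ht
  obtain ⟨d, hd⟩ := Int.eq_ofNat_of_zero_le (show 0 ≤ N - t by omega)
  have hsum := sum_dirichletSum_sq_mul_expMode hN (show d ≤ 2 * N by omega)
  have hterm (j : ℕ) : fejerWeight N j * expMode t (j / (2 * N)) = (4 * N : ℂ)⁻¹ *
      (dirichletSum N (j / (2 * N)) * (starRingEnd ℂ) (dirichletSum N (j / (2 * N))) *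
        expMode (-d) (j / (2 * N))) := by
    rw [fejerWeight, mul_assoc, mul_assoc, expMode_mul, show -(N : ℤ) + t = -d by omega]
  simp_rw [hterm]
  rw [← Finset.mul_sum, hsum]
  have hd' : (N : ℂ) - t = d := by exact_mod_cast hd
  rw [← hd']
  field_simp
  ring

/-- The derivative of `f` is given by the quadrature formula with weights `fejerWeight N`. -/
def HasFejerDeriv (N : ℕ) (f : ℝ → ℂ) : Prop :=
  ∀ x, HasDerivAt f (π * Complex.I *
    (∑ j ∈ Finset.range (4 * N), fejerWeight N j * f (x + j / (2 * N)) - N * f x)) x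

lemma HasFejerDeriv.add {N : ℕ} {f g : ℝ → ℂ} (hf : HasFejerDeriv N f) (hg : HasFejerDeriv N g) :
    HasFejerDeriv N (fun x => f x + g x) := by
  intro x
  refine ((hf x).add (hg x)).congr_deriv ?_
  simp only [mul_add, Finset.sum_add_distrib]
  ring

lemma HasFejerDeriv.const_mul {N : ℕ} {f : ℝ → ℂ} (c : ℂ) (hf : HasFejerDeriv N f) :
    HasFejerDeriv N (fun x => c * f x) := by
  intro x
  refine ((hf x).const_mul c).congr_deriv ?_
  have hsum : ∑ j ∈ Finset.range (4 * N), fejerWeight N j * (c * f (x + j / (2 * N))) =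
      c * ∑ j ∈ Finset.range (4 * N), fejerWeight N j * f (x + j / (2 * N)) := by
    rw [Finset.mul_sum]
    exact Finset.sum_congr rfl fun j _ => by ring
  rw [hsum]
  ring

lemma HasFejerDeriv.sum {N : ℕ} {ι : Type*} (s : Finset ι) {f : ι → ℝ → ℂ}
    (hf : ∀ i ∈ s, HasFejerDeriv N (f i)) : HasFejerDeriv N (fun x => ∑ i ∈ s, f i x) := by
  classical
  induction s using Finset.induction_on with
  | empty => intro x; simpa using hasDerivAt_const x (0 : ℂ)
  | insert i s hi ih =>
    simp only [Finset.sum_insert hi]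
    exact (hf i (Finset.mem_insert_self i s)).add
      (ih fun k hk => hf k (Finset.mem_insert_of_mem hk))

lemma hasFejerDeriv_expMode {N : ℕ} (hN : 0 < N) {t : ℤ} (ht : |t| ≤ N) :
    HasFejerDeriv N (expMode t) := by
  intro x
  refine (hasDerivAt_expMode t x).congr_deriv ?_
  have hsum : ∑ j ∈ Finset.range (4 * N), fejerWeight N j * expMode t (x + j / (2 * N)) =
      expMode t x * (t + N) := by
    rw [← sum_fejerWeight_mul_expMode hN ht, Finset.mul_sum]
    exact Finset.sum_congr rfl fun j _ => by rw [expMode_add]; ring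
  rw [hsum]
  ring

lemma IsTrigPoly.hasFejerDeriv {N : ℕ} (hN : 0 < N) {T : ℝ → ℝ} (hT : IsTrigPoly N T) :
    HasFejerDeriv N (fun x => (T x : ℂ)) := by
  obtain ⟨θ₀, a, b, h⟩ := hT
  have hrepr : (fun x => (T x : ℂ)) = fun x => θ₀ * expMode 0 x + ∑ t ∈ Finset.Icc 1 N,
      (a t * (1 / 2 * expMode t x + 1 / 2 * expMode (-t) x) +
        b t * (-Complex.I / 2 * expMode t x + Complex.I / 2 * expMode (-t) x)) := by
    funext x
    simp_rw [h x, ← ofReal_cos_eq_expMode, ← ofReal_sin_eq_expMode, expMode_zero]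
    push_cast
    ring
  rw [hrepr]
  refine ((hasFejerDeriv_expMode hN (by simp)).const_mul _).add (HasFejerDeriv.sum _ fun t ht => ?_)
  have htN := (Finset.mem_Icc.mp ht).2
  have hpos : HasFejerDeriv N (expMode t) := hasFejerDeriv_expMode hN (by rw [abs_le]; omega)
  have hneg : HasFejerDeriv N (expMode (-t)) := hasFejerDeriv_expMode hN (by rw [abs_le]; omega)
  exact (((hpos.const_mul _).add (hneg.const_mul _)).const_mul _).add
    (((hpos.const_mul _).add (hneg.const_mul _)).const_mul _)

/-- A weak form of Bernstein's inequality, integrated: a trigonometric polynomial bounded by `M`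
is Lipschitz with constant `3 * π * N * M`. -/
lemma IsTrigPoly.abs_sub_le {N : ℕ} (hN : 0 < N) {T : ℝ → ℝ} (hT : IsTrigPoly N T) {M : ℝ}
    (hM : ∀ x, |T x| ≤ M) (x y : ℝ) : |T x - T y| ≤ 3 * π * N * M * |x - y| := by
  have hderiv := hT.hasFejerDeriv hN
  have hnorm (z : ℝ) : ‖(T z : ℂ)‖ ≤ M := by
    rw [Complex.norm_real]
    exact hM z
  have hbound (z : ℝ) : ‖(π * Complex.I * (∑ j ∈ Finset.range (4 * N),
      fejerWeight N j * (T (z + j / (2 * N)) : ℂ) - N * (T z : ℂ)) : ℂ)‖ ≤ 3 * π * N * M := by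
    have hsum : ‖∑ j ∈ Finset.range (4 * N), fejerWeight N j * (T (z + j / (2 * N)) : ℂ)‖ ≤
        2 * N * M := by
      rw [← sum_norm_fejerWeight hN, Finset.sum_mul]
      refine norm_sum_le_of_le _ fun j _ => ?_
      rw [norm_mul]
      exact mul_le_mul_of_nonneg_left (hnorm _) (norm_nonneg _)
    have hlast : ‖(N * (T z : ℂ) : ℂ)‖ ≤ N * M := by
      rw [norm_mul, Complex.norm_natCast]
      exact mul_le_mul_of_nonneg_left (hnorm z) (Nat.cast_nonneg N)
    rw [norm_mul, norm_mul, Complex.norm_I, mul_one, Complex.norm_real,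
      Real.norm_of_nonneg Real.pi_pos.le]
    calc _ ≤ π * (2 * N * M + N * M) := by
          gcongr
          exact (norm_sub_le _ _).trans (add_le_add hsum hlast)
      _ = 3 * π * N * M := by ring
  have hmv := convex_univ.norm_image_sub_le_of_norm_hasDerivWithin_le
    (fun z _ => (hderiv z).hasDerivWithinAt) (fun z _ => hbound z) (Set.mem_univ y) (Set.mem_univ x)
  rw [← Complex.ofReal_sub, Complex.norm_real] at hmv
  exact hmv

lemma IsTrigPoly.continuous {N : ℕ} {T : ℝ → ℝ} (hT : IsTrigPoly N T) : Continuous T := by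
  obtain ⟨θ₀, a, b, h⟩ := hT
  rw [funext h]
  fun_prop

lemma IsTrigPoly.periodic {N : ℕ} {T : ℝ → ℝ} (hT : IsTrigPoly N T) : Function.Periodic T 2 := by
  obtain ⟨θ₀, a, b, h⟩ := hT
  intro x
  rw [h, h]
  congr 1
  refine Finset.sum_congr rfl fun t _ => ?_
  rw [show (t : ℝ) * π * (x + 2) = t * π * x + t * (2 * π) by ring,
    Real.cos_add_nat_mul_two_pi, Real.sin_add_nat_mul_two_pi]

/-- Let `N ≥ 1`, `ε > 0` with `4πεN < 1`, and let `C_ε ⊆ [-1,1]` be a finite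
`ε`-cover of `[-1,1]`. Then for every `T ∈ 𝕋_N`:
`sup_{x ∈ [-1,1]} |T(x)| ≤ (1 - 4πεN)⁻¹ · max_{x ∈ C_ε} |T(x)|`. -/
theorem sup_le_of_cover (N : ℕ) (hN : 0 < N) (ε : ℝ) (hε : 0 < ε)
    (hsmall : 4 * π * ε * N < 1) (Cε : Finset ℝ) (hsub : (Cε : Set ℝ) ⊆ Set.Icc (-1 : ℝ) 1)
    (hcover : ∀ x ∈ Set.Icc (-1 : ℝ) 1, ∃ x' ∈ Cε, |x - x'| ≤ ε)
    (T : ℝ → ℝ) (hT : IsTrigPoly N T) :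
    ∀ x ∈ Set.Icc (-1 : ℝ) 1,
      |T x| ≤ (1 - 4 * π * ε * N)⁻¹ * sSup ((fun y => |T y|) '' (Cε : Set ℝ)) := by
  intro x hx
  obtain ⟨x₀, hx₀, hmax⟩ := isCompact_Icc.exists_isMaxOn ⟨x, hx⟩ hT.continuous.abs.continuousOn
  have hM (y : ℝ) : |T y| ≤ |T x₀| := by
    obtain ⟨z, hz, hyz⟩ := hT.periodic.exists_mem_Ico (by norm_num) y (-1)
    rw [hyz]
    exact hmax ⟨hz.1, by linarith [hz.2]⟩
  obtain ⟨x', hx', hdist⟩ := hcover x₀ hx₀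
  have hlip : |T x₀ - T x'| ≤ 4 * π * ε * N * |T x₀| := by
    calc |T x₀ - T x'| ≤ 3 * π * N * |T x₀| * |x₀ - x'| := hT.abs_sub_le hN hM x₀ x'
      _ ≤ 4 * π * N * |T x₀| * ε := by gcongr; norm_num
      _ = 4 * π * ε * N * |T x₀| := by ring
  have htri : |T x₀| - |T x'| ≤ |T x₀ - T x'| := abs_sub_abs_le_abs_sub _ _
  have hsup : |T x'| ≤ sSup ((fun y => |T y|) '' (Cε : Set ℝ)) :=
    le_csSup (Cε.finite_toSet.image _).bddAbove ⟨x', hx', rfl⟩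
  refine (hM x).trans ?_
  rw [inv_mul_eq_div, le_div_iff₀ (by linarith)]
  linarith
end
end

section
/- Let N be a positive integer, d ≥ 1, and ε > 0 with 4πεN < 1, and let C_ε be a finite subset of [-1,1]^d such that for every x ∈ [-1,1]^d there exists x' ∈ C_ε with ‖x − x'‖₁ ≤ ε. Then for every multivariate trigonometric polynomial T ∈ 𝕋_{N,d}: sup_{x ∈ [-1,1]^d} |T(x)| ≤ (1 − 4πεN)^{-1} · max_{x ∈ C_ε} |T(x)|. -/
open Real MeasureTheory Set

noncomputable section

/-- A multivariate trigonometric polynomial of degree at most `N` on `[-1,1]^d`: a real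
linear combination of `x ↦ cos (π k·x)` and `x ↦ sin (π k·x)` over `k ∈ ℤ^d`, `‖k‖₁ ≤ N`. -/
def IsTrigPolyD (d N : ℕ) (T : (Fin d → ℝ) → ℝ) : Prop :=
  ∃ S : Finset (Fin d → ℤ), ∃ a b : (Fin d → ℤ) → ℝ,
    (∀ k ∈ S, (∑ j, (k j).natAbs) ≤ N) ∧
    ∀ x : Fin d → ℝ, T x = ∑ k ∈ S,
      (a k * Real.cos (π * ∑ j, (k j : ℝ) * x j) + b k * Real.sin (π * ∑ j, (k j : ℝ) * x j))

/-- The box `[-1,1]^d`. -/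
def box (d : ℕ) : Set (Fin d → ℝ) := Set.univ.pi fun _ => Set.Icc (-1 : ℝ) 1

/-- A function of exponential type `σ` bounded by `M` on the real line is bounded by
`M * exp (σ * Im w)` on the upper half-plane. -/
lemma norm_le_mul_exp_of_exponential_type {f : ℂ → ℂ} {K M σ : ℝ} (hf : Differentiable ℂ f)
    (hK : ∀ w, ‖f w‖ ≤ K * Real.exp (σ * |w.im|)) (hM : ∀ t : ℝ, ‖f t‖ ≤ M) {w : ℂ}
    (hw : 0 ≤ w.im) : ‖f w‖ ≤ M * Real.exp (σ * w.im) := by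
  let g : ℂ → ℂ := fun z => f (Complex.I * z) * Complex.exp (-σ * z)
  have hgd : Differentiable ℂ g := by
    have : Differentiable ℂ fun z : ℂ => f (Complex.I * z) := hf.comp (by fun_prop)
    exact this.mul (by fun_prop)
  have hnorm (z : ℂ) : ‖g z‖ = ‖f (Complex.I * z)‖ * Real.exp (-(σ * z.re)) := by
    simp [g, Complex.norm_exp]
  have hgK (z : ℂ) (hz : 0 ≤ z.re) : ‖g z‖ ≤ K := by
    rw [hnorm, Real.exp_neg, ← div_eq_mul_inv, div_le_iff₀ (Real.exp_pos _)]
    simpa [abs_of_nonneg hz] using hK (Complex.I * z)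
  have key : ‖g (-Complex.I * w)‖ ≤ M := by
    refine PhragmenLindelof.right_half_plane_of_bounded_on_real hgd.diffContOnCl
      ⟨0, by norm_num, 0, ?_⟩ ?_ ?_ (by simpa using hw)
    · refine Asymptotics.IsBigO.of_bound K ?_
      filter_upwards [Filter.mem_inf_of_right (Filter.mem_principal_self _)] with z hz
      simpa using hgK z (le_of_lt hz)
    · refine Filter.isBoundedUnder_of_eventually_le (a := K) ?_
      filter_upwards [Filter.eventually_ge_atTop 0] with x hx
      exact hgK x (by simpa using hx)
    · intro x
      have hx : Complex.I * (x * Complex.I) = ((-x : ℝ) : ℂ) := by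
        push_cast
        linear_combination (x : ℂ) * Complex.I_mul_I
      rw [hnorm, hx]
      simpa using hM (-x)
  have hIw : Complex.I * (-Complex.I * w) = w := by
    linear_combination -w * Complex.I_mul_I
  rw [hnorm, hIw, Real.exp_neg, ← div_eq_mul_inv, div_le_iff₀ (Real.exp_pos _)] at key
  simpa using key

/-- Bernstein's inequality, with the non-sharp constant `e`, for entire functions of exponential
type `σ` bounded by `M` on the real line. -/
lemma norm_deriv_le_of_exponential_type {f : ℂ → ℂ} {K M σ : ℝ} (hσ : 0 < σ)
    (hf : Differentiable ℂ f) (hK : ∀ w, ‖f w‖ ≤ K * Real.exp (σ * |w.im|))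
    (hM : ∀ t : ℝ, ‖f t‖ ≤ M) (t : ℝ) : ‖deriv f t‖ ≤ Real.exp 1 * σ * M := by
  have hM0 : 0 ≤ M := (norm_nonneg _).trans (hM 0)
  have hbound (w : ℂ) : ‖f w‖ ≤ M * Real.exp (σ * |w.im|) := by
    rcases le_total 0 w.im with hw | hw
    · simpa [abs_of_nonneg hw] using norm_le_mul_exp_of_exponential_type hf hK hM hw
    · have := norm_le_mul_exp_of_exponential_type (f := fun z => f (-z)) (w := -w)
        (hf.comp differentiable_neg) (fun z => by simpa using hK (-z))
        (fun s => by simpa using hM (-s)) (by simpa using hw)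
      simpa [abs_of_nonpos hw] using this
  have hC : ∀ z ∈ Metric.sphere (t : ℂ) σ⁻¹, ‖f z‖ ≤ M * Real.exp 1 := by
    intro z hz
    refine (hbound z).trans ?_
    gcongr
    have him : |z.im| ≤ σ⁻¹ := by
      have := Complex.abs_im_le_norm (z - t)
      rw [mem_sphere_iff_norm.mp hz] at this
      simpa using this
    calc σ * |z.im| ≤ σ * σ⁻¹ := by gcongr
      _ = 1 := mul_inv_cancel₀ hσ.ne'
  refine (Complex.norm_deriv_le_of_forall_mem_sphere_norm_le (inv_pos.mpr hσ)
    hf.diffContOnCl hC).trans (le_of_eq ?_)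
  rw [div_inv_eq_mul]
  ring

lemma Complex.norm_cos_le_exp_abs_im (w : ℂ) : ‖Complex.cos w‖ ≤ Real.exp |w.im| := by
  have h₁ : ‖Complex.exp (w * Complex.I)‖ ≤ Real.exp |w.im| := by
    simpa [Complex.norm_exp] using neg_le_abs w.im
  have h₂ : ‖Complex.exp (-w * Complex.I)‖ ≤ Real.exp |w.im| := by
    simpa [Complex.norm_exp] using le_abs_self w.im
  rw [Complex.cos, norm_div, Complex.norm_ofNat, div_le_iff₀ two_pos]
  linarith [norm_add_le (Complex.exp (w * Complex.I)) (Complex.exp (-w * Complex.I))]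

lemma Complex.norm_sin_le_exp_abs_im (w : ℂ) : ‖Complex.sin w‖ ≤ Real.exp |w.im| := by
  rw [← Complex.cos_sub_pi_div_two]
  simpa using Complex.norm_cos_le_exp_abs_im (w - π / 2)

/-- A real exponential sum with frequencies in `[-σ, σ]` that is bounded by `M` on the real line
is Lipschitz with constant `e * σ * M`. -/
lemma abs_sub_le_of_trig_sum {ι : Type*} (S : Finset ι) (a b α c : ι → ℝ) {f : ℝ → ℝ}
    {σ M : ℝ} (hσ : 0 < σ) (hc : ∀ k ∈ S, |c k| ≤ σ)
    (hf : ∀ t, f t = ∑ k ∈ S,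
      (a k * Real.cos (α k + c k * t) + b k * Real.sin (α k + c k * t)))
    (hM : ∀ t, |f t| ≤ M) (s t : ℝ) :
    |f t - f s| ≤ Real.exp 1 * σ * M * |t - s| := by
  let F : ℂ → ℂ := fun w => ∑ k ∈ S,
    (a k * Complex.cos (α k + c k * w) + b k * Complex.sin (α k + c k * w))
  have hFf (t : ℝ) : F t = (f t : ℂ) := by simp [F, hf]
  have hFd : Differentiable ℂ F := by fun_prop
  have hFK (w : ℂ) : ‖F w‖ ≤ (∑ k ∈ S, (|a k| + |b k|)) * Real.exp (σ * |w.im|) := by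
    rw [Finset.sum_mul]
    refine norm_sum_le_of_le S fun k hk => ?_
    have him : |((α k : ℂ) + c k * w).im| ≤ σ * |w.im| := by
      simp only [Complex.add_im, Complex.ofReal_im, Complex.im_ofReal_mul, zero_add, abs_mul]
      gcongr
      exact hc k hk
    have hcos := (Complex.norm_cos_le_exp_abs_im (α k + c k * w)).trans (Real.exp_le_exp.mpr him)
    have hsin := (Complex.norm_sin_le_exp_abs_im (α k + c k * w)).trans (Real.exp_le_exp.mpr him)
    refine (norm_add_le _ _).trans ?_
    simp only [norm_mul, Complex.norm_real, Real.norm_eq_abs, add_mul]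
    gcongr
  have hFM (t : ℝ) : ‖F t‖ ≤ M := by simpa [hFf] using hM t
  have hderiv (t : ℝ) : HasDerivAt (fun t : ℝ => F t) (deriv F t) t :=
    (hFd t).hasDerivAt.comp_ofReal
  have := convex_univ.norm_image_sub_le_of_norm_hasDerivWithin_le
    (fun x _ => (hderiv x).hasDerivWithinAt)
    (fun x _ => norm_deriv_le_of_exponential_type hσ hFd hFK hFM x) (mem_univ s) (mem_univ t)
  simpa only [hFf, ← Complex.ofReal_sub, Complex.norm_real, Real.norm_eq_abs] using this

namespace IsTrigPolyD

variable {d N : ℕ} {T : (Fin d → ℝ) → ℝ}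

lemma continuous (hT : IsTrigPolyD d N T) : Continuous T := by
  obtain ⟨S, a, b, -, h⟩ := hT
  rw [funext h]
  fun_prop

lemma exists_mem_box_eq (hT : IsTrigPolyD d N T) (x : Fin d → ℝ) : ∃ y ∈ box d, T y = T x := by
  obtain ⟨S, a, b, -, h⟩ := hT
  refine ⟨fun j => x j - 2 * round (x j / 2), fun j _ => ?_, ?_⟩
  · have := abs_le.mp (abs_sub_round (x j / 2))
    constructor <;> linarith
  · rw [h, h]
    refine Finset.sum_congr rfl fun k _ => ?_
    have hphase : π * ∑ j, (k j : ℝ) * (x j - 2 * round (x j / 2)) =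
        π * ∑ j, (k j : ℝ) * x j - (∑ j, k j * round (x j / 2) : ℤ) * (2 * π) := by
      push_cast
      simp only [mul_sub, Finset.sum_sub_distrib, Finset.mul_sum, Finset.sum_mul]
      congr 1
      exact Finset.sum_congr rfl fun j _ => by ring
    rw [hphase, Real.cos_sub_int_mul_two_pi, Real.sin_sub_int_mul_two_pi]

/-- A trigonometric polynomial of degree at most `N` bounded by `M` on the box is Lipschitz for
the `ℓ¹` distance. -/
lemma abs_sub_le (hT : IsTrigPolyD d N T) (hN : 0 < N) {M ε : ℝ} (hε : 0 < ε)
    (hM : ∀ x ∈ box d, |T x| ≤ M) {x y : Fin d → ℝ} (hxy : ∑ j, |x j - y j| ≤ ε) :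
    |T x - T y| ≤ Real.exp 1 * (π * N * ε) * M := by
  have hM' (z : Fin d → ℝ) : |T z| ≤ M := by
    obtain ⟨z', hz', h⟩ := hT.exists_mem_box_eq z
    exact h ▸ hM z' hz'
  obtain ⟨S, a, b, hS, h⟩ := hT
  have hN' : (0 : ℝ) < N := by exact_mod_cast hN
  have hfreq : ∀ k ∈ S, |π * ∑ j, (k j : ℝ) * (x j - y j)| ≤ π * N * ε := by
    intro k hk
    rw [abs_mul, abs_of_pos Real.pi_pos, mul_assoc]
    gcongr
    calc |∑ j, (k j : ℝ) * (x j - y j)|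
        ≤ ∑ j, |(k j : ℝ) * (x j - y j)| := Finset.abs_sum_le_sum_abs _ _
      _ ≤ ∑ j, (N : ℝ) * |x j - y j| := by
          refine Finset.sum_le_sum fun j _ => ?_
          rw [abs_mul]
          gcongr
          have hkj : (k j).natAbs ≤ N :=
            (Finset.single_le_sum (f := fun j => (k j).natAbs) (fun _ _ => Nat.zero_le _)
              (Finset.mem_univ j)).trans (hS k hk)
          rw [← Int.cast_abs, Int.abs_eq_natAbs]
          exact_mod_cast hkj
      _ ≤ N * ε := by
          rw [← Finset.mul_sum]
          gcongr
  have := abs_sub_le_of_trig_sum S a b (fun k => π * ∑ j, (k j : ℝ) * y j)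
    (fun k => π * ∑ j, (k j : ℝ) * (x j - y j)) (f := fun t => T (y + t • (x - y)))
    (by positivity) hfreq
    (fun t => by
      rw [h]
      refine Finset.sum_congr rfl fun k _ => ?_
      have hphase : π * ∑ j, (k j : ℝ) * (y + t • (x - y)) j =
          π * ∑ j, (k j : ℝ) * y j + π * (∑ j, (k j : ℝ) * (x j - y j)) * t := by
        rw [mul_assoc, ← mul_add, Finset.sum_mul, ← Finset.sum_add_distrib]
        congr 1
        refine Finset.sum_congr rfl fun j _ => ?_
        simp only [Pi.add_apply, Pi.smul_apply, Pi.sub_apply, smul_eq_mul]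
        ring
      rw [hphase])
    (fun t => hM' _) 0 1
  simpa using this

end IsTrigPolyD

/-- Let `N ≥ 1`, `d ≥ 1`, `ε > 0` with `4πεN < 1`, and let
`C_ε ⊆ [-1,1]^d` be finite and such that every `x ∈ [-1,1]^d` has some `x' ∈ C_ε` with
`‖x - x'‖₁ ≤ ε`. Then for every `T ∈ 𝕋_{N,d}`:
`sup_{x ∈ [-1,1]^d} |T(x)| ≤ (1 - 4πεN)⁻¹ · max_{x ∈ C_ε} |T(x)|`. -/
theorem sup_le_of_cover_multivariate (d N : ℕ) (hd : 1 ≤ d) (hN : 0 < N) (ε : ℝ)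
    (hε : 0 < ε) (hsmall : 4 * π * ε * N < 1) (Cε : Finset (Fin d → ℝ))
    (hsub : (Cε : Set (Fin d → ℝ)) ⊆ box d)
    (hcover : ∀ x ∈ box d, ∃ x' ∈ Cε, (∑ j, |x j - x' j|) ≤ ε)
    (T : (Fin d → ℝ) → ℝ) (hT : IsTrigPolyD d N T) :
    ∀ x ∈ box d,
      |T x| ≤ (1 - 4 * π * ε * N)⁻¹ * sSup ((fun y => |T y|) '' (Cε : Set (Fin d → ℝ))) := by
  have hcompact : IsCompact (box d) := isCompact_univ_pi fun _ => isCompact_Icc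
  intro x hx
  obtain ⟨x₀, hx₀, hmax⟩ := hcompact.exists_isMaxOn ⟨x, hx⟩ hT.continuous.abs.continuousOn
  obtain ⟨y, hy, hxy⟩ := hcover x₀ hx₀
  have hlip := hT.abs_sub_le hN hε hmax hxy
  have hsup : |T y| ≤ sSup ((fun y => |T y|) '' (Cε : Set (Fin d → ℝ))) :=
    le_csSup (Cε.finite_toSet.image _).bddAbove (mem_image_of_mem _ hy)
  have hconst : Real.exp 1 * (π * N * ε) * |T x₀| ≤ 4 * (π * N * ε) * |T x₀| := by
    gcongr
    linarith [Real.exp_one_lt_three]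
  rw [inv_mul_eq_div, le_div_iff₀ (by linarith)]
  calc |T x| * (1 - 4 * π * ε * N) ≤ |T x₀| * (1 - 4 * π * ε * N) :=
        mul_le_mul_of_nonneg_right (hmax hx) (by linarith)
    _ ≤ |T y| := by linarith [abs_sub_abs_le_abs_sub (T x₀) (T y)]
    _ ≤ _ := hsup
end
end
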